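/- Let μ and ν be Borel probability measures on ℝ^d, with μ absolutely continuous with respect to the Lebesgue measure. Then there exists a sequence of differentiable convex functions F_n : ℝ^d → ℝ such that the pushforward measures (∇F_n)_* μ converge weakly (i.e., in distribution) to ν as n → ∞. -/

import Mathlib

set_option linter.unusedSectionVars false
open MeasureTheory Filter Topology Set

namespace GP
variable {d : ℕ} {ι : Type*} [Fintype ι] [DecidableEq ι]

/-- Laguerre cells. -/
def cell (y : ι → EuclideanSpace ℝ (Fin d)) (c : ι → ℝ) (i : ι) : Set (EuclideanSpace ℝ (Fin d)) :=
  {x | ∀ j, j ≠ i → inner ℝ x (y j) - c j < inner ℝ x (y i) - c i}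

lemma isOpen_cell (y : ι → EuclideanSpace ℝ (Fin d)) (c : ι → ℝ) (i : ι) :
    IsOpen (cell y c i) := by
  have : cell y c i = ⋂ j, ⋂ (_ : j ≠ i),
      {x | inner ℝ x (y j) - c j < inner ℝ x (y i) - c i} := by
    ext x; simp [cell]
  rw [this]
  refine isOpen_iInter_of_finite fun j => isOpen_iInter_of_finite fun _ => ?_
  exact isOpen_lt (by fun_prop) (by fun_prop)

lemma null_hyper (v : EuclideanSpace ℝ (Fin d)) (hv : v ≠ 0) (t : ℝ) :
    volume {x : EuclideanSpace ℝ (Fin d) | inner ℝ x v = t} = 0 := by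
  let A : AffineSubspace ℝ (EuclideanSpace ℝ (Fin d)) :=
    { carrier := {x | inner ℝ x v = t}
      smul_vsub_vadd_mem' := by
        intro a p q r hp hq hr
        simp only [mem_ofPred_eq] at *
        simp [inner_add_left, inner_smul_left, inner_sub_left, hp, hq, hr] }
  have h := Measure.addHaar_affineSubspace (volume : Measure (EuclideanSpace ℝ (Fin d))) A ?_
  · exact h
  · intro h
    have h0 : ∀ x : EuclideanSpace ℝ (Fin d), inner ℝ x v = t := by
      intro x
      have : x ∈ A := by rw [h]; trivial
      exact this
    have h1 := h0 0
    have h2 := h0 v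
    rw [inner_zero_left] at h1
    rw [← h1] at h2
    exact hv (inner_self_eq_zero.1 h2)

/-- no ties -/
lemma ae_no_tie (μ : Measure (EuclideanSpace ℝ (Fin d))) (hac : μ ≪ volume)
    (y : ι → EuclideanSpace ℝ (Fin d)) (hy : Function.Injective y) (c : ι → ℝ) :
    ∀ᵐ x ∂μ, ∀ i j, i ≠ j → inner ℝ x (y i) - c i ≠ inner ℝ x (y j) - c j := by
  rw [ae_all_iff]; intro i
  rw [ae_all_iff]; intro j
  by_cases hij : i = j
  · simp [hij]
  refine hac.ae_le ?_
  have := null_hyper (y i - y j) (sub_ne_zero.2 (hy.ne hij)) (c i - c j)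
  rw [measure_eq_zero_iff_ae_notMem] at this
  filter_upwards [this] with x hx _ h
  apply hx
  simp only [inner_sub_right]
  linarith

lemma exists_cell [Nonempty ι] (y : ι → EuclideanSpace ℝ (Fin d)) (c : ι → ℝ)
    (x : EuclideanSpace ℝ (Fin d))
    (hx : ∀ i j, i ≠ j → inner ℝ x (y i) - c i ≠ inner ℝ x (y j) - c j) :
    ∃ i, x ∈ cell y c i := by
  obtain ⟨i, hi⟩ := Finite.exists_max (fun i => inner ℝ x (y i) - c i)
  exact ⟨i, fun j hj => lt_of_le_of_ne (hi j) (hx j i hj)⟩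

lemma cell_unique (y : ι → EuclideanSpace ℝ (Fin d)) (c : ι → ℝ)
    (x : EuclideanSpace ℝ (Fin d)) {i j : ι} (hi : x ∈ cell y c i) (hj : x ∈ cell y c j) :
    i = j := by
  by_contra h
  exact lt_asymm (hi j (Ne.symm h)) (hj i h)

lemma sum_mass [Nonempty ι] (μ : Measure (EuclideanSpace ℝ (Fin d))) [IsProbabilityMeasure μ]
    (hac : μ ≪ volume)
    (y : ι → EuclideanSpace ℝ (Fin d)) (hy : Function.Injective y) (c : ι → ℝ) :
    ∑ i, μ.real (cell y c i) = 1 := by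
  rw [← measureReal_iUnion_fintype]
  · rw [measureReal_def, prob_compl_eq_zero_iff (MeasurableSet.iUnion fun i => (isOpen_cell y c i).measurableSet) |>.1]
    · simp
    · rw [← mem_ae_iff]
      filter_upwards [ae_no_tie μ hac y hy c] with x hx
      exact mem_iUnion.2 (exists_cell y c x hx)
  · intro i j hij
    exact Set.disjoint_left.2 fun x hi hj => hij (cell_unique y c x hi hj)
  · exact fun i => (isOpen_cell y c i).measurableSet

lemma continuous_mass (μ : Measure (EuclideanSpace ℝ (Fin d))) [IsProbabilityMeasure μ]
    (hac : μ ≪ volume)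
    (y : ι → EuclideanSpace ℝ (Fin d)) (hy : Function.Injective y) (i : ι) :
    Continuous (fun c => μ.real (cell y c i)) := by
  rw [continuous_iff_continuousAt]
  intro c
  have key : Tendsto (fun c => μ (cell y c i)) (𝓝 c) (𝓝 (μ (cell y c i))) := by
    refine tendsto_measure_of_ae_tendsto_indicator_of_isFiniteMeasure (𝓝 c)
      (isOpen_cell y c i).measurableSet (fun c => (isOpen_cell y c i).measurableSet) ?_
    filter_upwards [ae_no_tie μ hac y hy c] with x hx
    have hcont : ∀ j, ContinuousAt (fun c : ι → ℝ => inner ℝ x (y j) - c j) c := fun j =>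
      (continuous_const.sub (continuous_apply j)).continuousAt
    by_cases h : x ∈ cell y c i
    · have : ∀ᶠ c' in 𝓝 c, ∀ j, j ≠ i → inner ℝ x (y j) - c' j < inner ℝ x (y i) - c' i := by
        rw [eventually_all]; intro j
        by_cases hj : j = i
        · simp [hj]
        filter_upwards [(hcont j).eventually_lt (hcont i) (h j hj)] with c' hc' _ using hc'
      filter_upwards [this] with c' hc'
      exact ⟨fun _ => h, fun _ => hc'⟩
    · have h' := h
      simp only [cell, mem_ofPred_eq, not_forall] at h'
      obtain ⟨j, hj, hlt⟩ := h'
      have hlt' : inner ℝ x (y i) - c i < inner ℝ x (y j) - c j :=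
        lt_of_le_of_ne (not_lt.1 hlt) (hx i j (Ne.symm hj))
      filter_upwards [(hcont i).eventually_lt (hcont j) hlt'] with c' hc'
      exact ⟨fun hh => absurd (hh j hj) (not_lt.2 hc'.le), fun hh => absurd hh h⟩
  exact (ENNReal.tendsto_toReal (measure_ne_top _ _)).comp key

lemma tail_small (μ : Measure (EuclideanSpace ℝ (Fin d))) [IsProbabilityMeasure μ]
    (v : EuclideanSpace ℝ (Fin d)) {ε : ℝ} (hε : 0 < ε) :
    ∃ K : ℝ, ∀ K' ≥ K, μ.real {x | K' < inner ℝ x v} < ε := by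
  have key : Tendsto (fun K : ℝ => μ {x | K < inner ℝ x v}) atTop (𝓝 (μ ∅)) := by
    refine tendsto_measure_of_ae_tendsto_indicator_of_isFiniteMeasure atTop
      MeasurableSet.empty (fun K => (isOpen_lt (by fun_prop) (by fun_prop)).measurableSet) ?_
    filter_upwards with x
    filter_upwards [eventually_ge_atTop (inner ℝ x v)] with K hK
    simp [hK]
  have key2 := (ENNReal.tendsto_toReal (measure_ne_top _ _)).comp key
  simp only [measure_empty, ENNReal.toReal_zero] at key2
  exact eventually_atTop.1 (key2.eventually_lt_const hε)

lemma exists_weights (μ : Measure (EuclideanSpace ℝ (Fin d))) [IsProbabilityMeasure μ]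
    (hac : μ ≪ volume)
    (y : ι → EuclideanSpace ℝ (Fin d)) (hy : Function.Injective y)
    (w : ι → ℝ) (hw : ∀ i, 0 < w i) (hw1 : ∑ i, w i = 1) :
    ∃ c : ι → ℝ, ∀ i, μ.real (cell y c i) = w i := by
  have hne : Nonempty ι := by
    by_contra h
    rw [not_nonempty_iff] at h
    simp at hw1
  obtain ⟨i0⟩ := id hne
  let S : Set (ι → ℝ) := {c | c i0 = 0 ∧ ∀ i, i ≠ i0 → μ.real (cell y c i) ≤ w i}
  have hcm := continuous_mass μ hac y hy
  have hSclosed : IsClosed S := by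
    have : S = {c | c i0 = 0} ∩ ⋂ i, ⋂ (_ : i ≠ i0), {c | μ.real (cell y c i) ≤ w i} := by
      ext c; simp [S]
    rw [this]
    refine (isClosed_eq (by fun_prop) (by fun_prop)).inter
      (isClosed_iInter fun i => isClosed_iInter fun _ => isClosed_le (hcm i) continuous_const)
  -- lower bound
  have hL : ∃ L : ι → ℝ, ∀ c ∈ S, L ≤ c := by
    choose K hK using fun j => tail_small μ (y i0 - y j) (hw i0)
    refine ⟨fun j => min 0 (-K j), fun c hc j => ?_⟩
    by_cases hj : j = i0
    · subst hj; rw [hc.1]; exact min_le_left _ _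
    refine (min_le_right _ _).trans ?_
    by_contra hlt
    push Not at hlt
    have h1 := hK j (-c j) (by linarith)
    have h2 : μ.real (cell y c i0) ≤ μ.real {x | -c j < inner ℝ x (y i0 - y j)} := by
      refine measureReal_mono fun x hx => ?_
      have := hx j hj
      rw [hc.1] at this
      simp only [mem_ofPred_eq, inner_sub_right]
      linarith
    have h3 := sum_mass μ hac y hy c
    rw [← hw1, ← Finset.add_sum_erase _ _ (Finset.mem_univ i0),
      ← Finset.add_sum_erase _ _ (Finset.mem_univ i0)] at h3
    have h4 : ∑ i ∈ Finset.univ.erase i0, μ.real (cell y c i)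
        ≤ ∑ i ∈ Finset.univ.erase i0, w i :=
      Finset.sum_le_sum fun i hi => hc.2 i (Finset.ne_of_mem_erase hi)
    linarith
  -- nonempty
  have hN : S.Nonempty := by
    choose K hK using fun j => tail_small μ (y j - y i0) (hw j)
    refine ⟨fun j => if j = i0 then 0 else K j, by simp, fun i hi => ?_⟩
    refine le_trans (measureReal_mono fun x hx => ?_) (hK i (K i) le_rfl).le
    have := hx i0 (Ne.symm hi)
    simp only [if_true, hi, if_false] at this
    simp only [mem_ofPred_eq, inner_sub_right]
    linarith
  obtain ⟨L, hL⟩ := hL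
  obtain ⟨c0, hc0⟩ := hN
  have hcomp : IsCompact (S ∩ Icc L c0) := isCompact_Icc.inter_left hSclosed
  obtain ⟨c, ⟨hcS, hcI⟩, hmin⟩ := hcomp.exists_isMinOn ⟨c0, hc0, hL c0 hc0, le_rfl⟩
    (f := fun c => ∑ i, c i) (by fun_prop)
  have heq : ∀ i, i ≠ i0 → μ.real (cell y c i) = w i := by
    intro i hi
    refine le_antisymm (hcS.2 i hi) ?_
    by_contra hlt
    push Not at hlt
    have hcont : Continuous fun ε : ℝ =>
        μ.real (cell y (Function.update c i (c i - ε)) i) :=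
      (hcm i).comp (continuous_const.update i (by fun_prop))
    have hev : ∀ᶠ ε in 𝓝[>] (0 : ℝ),
        μ.real (cell y (Function.update c i (c i - ε)) i) < w i := by
      apply (hcont.tendsto 0).mono_left nhdsWithin_le_nhds |>.eventually_lt_const
      simpa using hlt
    obtain ⟨ε, hε, hεpos⟩ := (hev.and self_mem_nhdsWithin).exists
    have hεpos : 0 < ε := hεpos
    set c' := Function.update c i (c i - ε) with hc'
    have hc'le : c' ≤ c := by
      intro j
      by_cases hj : j = i
      · subst hj; simp [hc', hεpos.le]
      · simp [hc', hj]
    have hc'S : c' ∈ S := by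
      refine ⟨by simp [hc', Ne.symm hi, hcS.1], fun j hj => ?_⟩
      by_cases hji : j = i
      · subst hji; exact hε.le
      · have hsub : cell y c' j ⊆ cell y c j := ?_
        · exact le_trans (measureReal_mono hsub) (hcS.2 j hj)
        intro x hx k hk
        have h1 := hx k hk
        have h2 := hc'le k
        have h3 : c' j = c j := by simp [hc', hji]
        rw [h3] at h1
        linarith
    have hm := hmin (show c' ∈ S ∩ Icc L c0 from ⟨hc'S, hL c' hc'S, hc'le.trans hcI.2⟩)
    simp only [mem_ofPred_eq] at hm
    have hlt2 : ∑ j, c' j < ∑ j, c j :=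
      Finset.sum_lt_sum (fun j _ => hc'le j) ⟨i, Finset.mem_univ _, by simp [hc', hεpos]⟩
    linarith
  refine ⟨c, fun i => ?_⟩
  by_cases hi : i = i0
  · subst hi
    have h3 := sum_mass μ hac y hy c
    rw [← hw1, ← Finset.add_sum_erase _ _ (Finset.mem_univ i),
      ← Finset.add_sum_erase _ _ (Finset.mem_univ i)] at h3
    have h4 : ∑ j ∈ Finset.univ.erase i, μ.real (cell y c j)
        = ∑ j ∈ Finset.univ.erase i, w j :=
      Finset.sum_congr rfl fun j hj => heq j (Finset.ne_of_mem_erase hj)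
    linarith
  · exact heq i hi


/-- log-sum-exp potential -/
noncomputable def lse (y : ι → EuclideanSpace ℝ (Fin d)) (c : ι → ℝ) (t : ℝ)
    (x : EuclideanSpace ℝ (Fin d)) : ℝ :=
  t⁻¹ * Real.log (∑ i, Real.exp (t * (inner ℝ x (y i) - c i)))

/-- softmax weights -/
noncomputable def sm (y : ι → EuclideanSpace ℝ (Fin d)) (c : ι → ℝ) (t : ℝ)
    (x : EuclideanSpace ℝ (Fin d)) (i : ι) : ℝ :=
  Real.exp (t * (inner ℝ x (y i) - c i)) / ∑ j, Real.exp (t * (inner ℝ x (y j) - c j))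

lemma sum_exp_pos [Nonempty ι] (a : ι → ℝ) : 0 < ∑ i, Real.exp (a i) :=
  Finset.sum_pos (fun _ _ => Real.exp_pos _) Finset.univ_nonempty

lemma hasGradientAt_lse [Nonempty ι] (y : ι → EuclideanSpace ℝ (Fin d)) (c : ι → ℝ) {t : ℝ}
    (ht : 0 < t) (x : EuclideanSpace ℝ (Fin d)) :
    HasGradientAt (lse y c t) (∑ i, sm y c t x i • y i) x := by
  rw [hasGradientAt_iff_hasFDerivAt]
  have hpos := sum_exp_pos (fun i => t * (inner ℝ x (y i) - c i))
  have h1 : ∀ i, HasFDerivAt (fun x : EuclideanSpace ℝ (Fin d) => t * (inner ℝ x (y i) - c i))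
      (t • (InnerProductSpace.toDual ℝ (EuclideanSpace ℝ (Fin d)) (y i))) x := by
    intro i
    have h0 : HasFDerivAt (fun x : EuclideanSpace ℝ (Fin d) => inner ℝ x (y i))
        (InnerProductSpace.toDual ℝ (EuclideanSpace ℝ (Fin d)) (y i)) x := by
      have := (InnerProductSpace.toDual ℝ (EuclideanSpace ℝ (Fin d)) (y i)).hasFDerivAt (x := x)
      refine this.congr_of_eventuallyEq (Eventually.of_forall fun z => ?_)
      simp [real_inner_comm]
    exact (h0.sub_const (c i)).const_mul t
  have h2 := HasFDerivAt.fun_sum (u := Finset.univ) fun i _ => (h1 i).exp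
  have h3 := (h2.log hpos.ne').const_mul t⁻¹
  refine h3.congr_fderiv ?_
  ext z
  simp only [map_sum, sm, map_smul, _root_.smul_apply, _root_.sum_apply,
    smul_eq_mul, Finset.mul_sum, InnerProductSpace.toDual_apply_apply]
  refine Finset.sum_congr rfl fun i _ => ?_
  field_simp

lemma convexOn_lse [Nonempty ι] (y : ι → EuclideanSpace ℝ (Fin d)) (c : ι → ℝ) {t : ℝ}
    (ht : 0 < t) : ConvexOn ℝ univ (lse y c t) := by
  refine ⟨convex_univ, fun x _ z _ a b ha hb hab => ?_⟩
  simp only [lse, smul_eq_mul]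
  have hA := sum_exp_pos (fun i => t * (inner ℝ x (y i) - c i))
  have hB := sum_exp_pos (fun i => t * (inner ℝ z (y i) - c i))
  set A := ∑ i, Real.exp (t * (inner ℝ x (y i) - c i)) with hAdef
  set B := ∑ i, Real.exp (t * (inner ℝ z (y i) - c i)) with hBdef
  have key : ∑ i, Real.exp (t * (inner ℝ (a • x + b • z) (y i) - c i))
      ≤ Real.exp (a * Real.log A + b * Real.log B) := by
    have hi : ∀ i, Real.exp (t * (inner ℝ (a • x + b • z) (y i) - c i)) ≤
        Real.exp (a * Real.log A + b * Real.log B) *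
        (a * (Real.exp (t * (inner ℝ x (y i) - c i)) / A)
          + b * (Real.exp (t * (inner ℝ z (y i) - c i)) / B)) := by
      intro i
      have hcx := convexOn_exp.2 (mem_univ (t * (inner ℝ x (y i) - c i) - Real.log A))
        (mem_univ (t * (inner ℝ z (y i) - c i) - Real.log B)) ha hb hab
      simp only [smul_eq_mul, Real.exp_sub _ (Real.log _), Real.exp_log hA, Real.exp_log hB] at hcx
      refine le_trans (le_of_eq ?_) (mul_le_mul_of_nonneg_left hcx (Real.exp_pos _).le)
      rw [← Real.exp_add]
      congr 1
      simp only [inner_add_left, inner_smul_left, conj_trivial]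
      have : b = 1 - a := by linarith
      subst this
      ring
    refine (Finset.sum_le_sum fun i _ => hi i).trans (le_of_eq ?_)
    rw [← Finset.mul_sum, Finset.sum_add_distrib, ← Finset.mul_sum, ← Finset.mul_sum,
      ← Finset.sum_div, ← Finset.sum_div, ← hAdef, ← hBdef, div_self hA.ne', div_self hB.ne']
    rw [mul_one, mul_one, hab, mul_one]
  have h := Real.log_le_log (sum_exp_pos _) key
  rw [Real.log_exp] at h
  have := mul_le_mul_of_nonneg_left h (inv_pos.2 ht).le
  linarith

lemma tendsto_grad [Nonempty ι] (y : ι → EuclideanSpace ℝ (Fin d)) (c : ι → ℝ)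
    (x : EuclideanSpace ℝ (Fin d)) (i : ι) (hx : x ∈ cell y c i) :
    Tendsto (fun t : ℝ => ∑ j, sm y c t x j • y j) atTop (𝓝 (y i)) := by
  have hs : ∀ t, ∑ j, sm y c t x j = 1 := fun t => by
    simp only [sm]
    rw [← Finset.sum_div]
    exact div_self (sum_exp_pos _).ne'
  have h1 : ∀ t, ∑ j, sm y c t x j • y j = y i + ∑ j, sm y c t x j • (y j - y i) := by
    intro t
    simp only [smul_sub, Finset.sum_sub_distrib, ← Finset.sum_smul, hs]
    simp
  simp only [h1]
  have h2 : Tendsto (fun t : ℝ => ∑ j, sm y c t x j • (y j - y i)) atTop (𝓝 (∑ j : ι, 0)) := by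
    refine tendsto_finsetSum _ fun j _ => ?_
    by_cases hj : j = i
    · subst hj; simp
    have h3 : Tendsto (fun t : ℝ => sm y c t x j) atTop (𝓝 0) := by
      have hlt := hx j hj
      have hlim : Tendsto (fun t : ℝ => Real.exp (t * ((inner ℝ x (y j) - c j)
          - (inner ℝ x (y i) - c i)))) atTop (𝓝 0) := by
        refine Real.tendsto_exp_atBot.comp ?_
        exact tendsto_id.atTop_mul_const_of_neg (by linarith)
      refine squeeze_zero (fun t => div_nonneg (Real.exp_pos _).le (sum_exp_pos _).le)
        (fun t => ?_) hlim
      rw [sm, div_le_iff₀ (sum_exp_pos _)]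
      refine le_trans (le_of_eq ?_) (mul_le_mul_of_nonneg_left
        (Finset.single_le_sum (f := fun j => Real.exp (t * (inner ℝ x (y j) - c j)))
          (fun k _ => (Real.exp_pos _).le) (Finset.mem_univ i)) (Real.exp_pos _).le)
      rw [← Real.exp_add]
      congr 1
      ring
    simpa using h3.smul_const (y j - y i)
  simpa using h2.const_add (y i)

lemma continuous_grad [Nonempty ι] (y : ι → EuclideanSpace ℝ (Fin d)) (c : ι → ℝ) (t : ℝ) :
    Continuous (fun x => ∑ j, sm y c t x j • y j) := by
  refine continuous_finsetSum _ fun j _ => Continuous.fun_smul ?_ continuous_const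
  simp only [sm]
  exact Continuous.div (by fun_prop) (by fun_prop) fun x => (sum_exp_pos _).ne'

lemma finite_case (μ : Measure (EuclideanSpace ℝ (Fin d))) [IsProbabilityMeasure μ]
    (hac : μ ≪ volume)
    (y : ι → EuclideanSpace ℝ (Fin d)) (hy : Function.Injective y)
    (w : ι → ℝ) (hw : ∀ i, 0 < w i) (hw1 : ∑ i, w i = 1) :
    ∃ F : ℕ → EuclideanSpace ℝ (Fin d) → ℝ,
      (∀ n, Differentiable ℝ (F n) ∧ ConvexOn ℝ univ (F n) ∧ Measurable (gradient (F n))) ∧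
      ∀ g : BoundedContinuousFunction (EuclideanSpace ℝ (Fin d)) ℝ,
        Tendsto (fun n => ∫ x, g (gradient (F n) x) ∂μ) atTop (𝓝 (∑ i, w i * g (y i))) := by
  have hne : Nonempty ι := by
    by_contra h
    rw [not_nonempty_iff] at h
    simp at hw1
  obtain ⟨c, hc⟩ := exists_weights μ hac y hy w hw hw1
  have hn : ∀ n : ℕ, (0 : ℝ) < (n : ℝ) + 1 := fun n => by positivity
  have hg : ∀ n : ℕ, gradient (lse y c ((n : ℝ) + 1)) =
      fun x => ∑ j, sm y c ((n : ℝ) + 1) x j • y j :=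
    fun n => gradient_eq fun x => hasGradientAt_lse y c (hn n) x
  refine ⟨fun n => lse y c ((n : ℝ) + 1), fun n => ⟨fun x =>
    (hasGradientAt_lse y c (hn n) x).differentiableAt, convexOn_lse y c (hn n), ?_⟩, fun g => ?_⟩
  · rw [hg]; exact (continuous_grad y c _).measurable
  simp only [hg]
  have hlim : ∑ i, w i * g (y i) = ∫ x, ∑ i, (cell y c i).indicator (fun _ => g (y i)) x ∂μ := by
    rw [integral_finsetSum]
    · refine Finset.sum_congr rfl fun i _ => ?_
      rw [integral_indicator_const _ (isOpen_cell y c i).measurableSet, hc, smul_eq_mul]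
    · exact fun i _ => (integrable_const _).indicator (isOpen_cell y c i).measurableSet
  rw [hlim]
  refine tendsto_integral_of_dominated_convergence (fun _ => ‖g‖) (fun n => ?_)
    (integrable_const _) (fun n => Eventually.of_forall fun x => g.norm_coe_le_norm _) ?_
  · exact (g.continuous.comp (continuous_grad y c _)).aestronglyMeasurable
  · filter_upwards [ae_no_tie μ hac y hy c] with x hx
    obtain ⟨i, hi⟩ := exists_cell y c x hx
    have h1 : ∑ j, (cell y c j).indicator (fun _ => g (y j)) x = g (y i) := by
      rw [Finset.sum_eq_single i]
      · simp [hi]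
      · intro j _ hj
        exact indicator_of_notMem (fun h => hj (cell_unique y c x h hi)) _
      · simp
    rw [h1]
    have h2 : Tendsto (fun n : ℕ => (n : ℝ) + 1) atTop atTop :=
      tendsto_atTop_add_const_right _ _ tendsto_natCast_atTop_atTop
    exact (g.continuous.tendsto _).comp ((tendsto_grad y c x i hi).comp h2)

/-- The set of gradient pushforwards. -/
def gradSet (μ : Measure (EuclideanSpace ℝ (Fin d))) :
    Set (ProbabilityMeasure (EuclideanSpace ℝ (Fin d))) :=
  {ρ | ∃ F : EuclideanSpace ℝ (Fin d) → ℝ, Differentiable ℝ F ∧ ConvexOn ℝ univ F ∧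
    (ρ : Measure _) = μ.map (gradient F)}

lemma simple_mem_closure (μ ν : Measure (EuclideanSpace ℝ (Fin d))) [IsProbabilityMeasure μ]
    [IsProbabilityMeasure ν] (hac : μ ≪ volume)
    (f : SimpleFunc (EuclideanSpace ℝ (Fin d)) (EuclideanSpace ℝ (Fin d)))
    (ρ : ProbabilityMeasure (EuclideanSpace ℝ (Fin d))) (hρ : (ρ : Measure _) = ν.map f) :
    ρ ∈ closure (gradSet μ) := by
  classical
  let s : Finset (EuclideanSpace ℝ (Fin d)) :=
    f.range.filter fun z => 0 < ν.real (f ⁻¹' {z})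
  have hsum : ∀ g : EuclideanSpace ℝ (Fin d) → ℝ,
      ∑ z : s, ν.real (f ⁻¹' {z.1}) * g z = ∫ x, g (f x) ∂ν := by
    intro g
    have h1 : ∀ x, g (f x) = ∑ z ∈ f.range, (f ⁻¹' {z}).indicator (fun _ => g z) x := by
      intro x
      rw [Finset.sum_eq_single (f x)]
      · simp
      · intro z _ hz
        have hx : x ∉ f ⁻¹' {z} := by
          intro h
          have h' : f x = z := h
          exact hz h'.symm
        simp [hx]
      · intro h
        exact absurd (f.mem_range_self x) h
    simp only [h1]
    rw [integral_finsetSum f.range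
      (f := fun z x => (f ⁻¹' {z}).indicator (fun _ => g z) x)
      fun z _ => (integrable_const (g z)).indicator (f.measurableSet_fiber z)]
    have h2 : ∀ z ∈ f.range, ∫ x, (f ⁻¹' {z}).indicator (fun _ => g z) x ∂ν
        = ν.real (f ⁻¹' {z}) * g z := fun z _ => by
      rw [integral_indicator_const _ (f.measurableSet_fiber z), smul_eq_mul]
    rw [Finset.sum_congr rfl h2, Finset.sum_coe_sort s fun z => ν.real (f ⁻¹' {z}) * g z]
    refine Finset.sum_subset (Finset.filter_subset _ _) fun z hz hzs => ?_
    have h3 : ν.real (f ⁻¹' {z}) = 0 := by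
      by_contra hne
      exact hzs (Finset.mem_filter.2 ⟨hz, lt_of_le_of_ne measureReal_nonneg (Ne.symm hne)⟩)
    rw [h3, zero_mul]
  have hw1 : ∑ z : s, ν.real (f ⁻¹' {z.1}) = 1 := by
    simpa using hsum fun _ => 1
  obtain ⟨F, hF, hlim⟩ := finite_case μ hac (fun z : s => z.1) Subtype.val_injective
    (fun z => ν.real (f ⁻¹' {z.1})) (fun z => (Finset.mem_filter.1 z.2).2) hw1
  let ρs : ℕ → ProbabilityMeasure (EuclideanSpace ℝ (Fin d)) := fun n =>
    ⟨μ.map (gradient (F n)), Measure.isProbabilityMeasure_map (hF n).2.2.aemeasurable⟩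
  refine mem_closure_of_tendsto (f := ρs) (b := atTop) ?_
    (Eventually.of_forall fun n => ⟨F n, (hF n).1, (hF n).2.1, rfl⟩)
  rw [ProbabilityMeasure.tendsto_iff_forall_integral_tendsto]
  intro g
  have h := hlim g
  rw [hsum] at h
  rw [hρ, integral_map f.measurable.aemeasurable g.continuous.aestronglyMeasurable]
  refine h.congr fun n => ?_
  exact (integral_map (hF n).2.2.aemeasurable g.continuous.aestronglyMeasurable).symm

lemma mem_closure (μ : Measure (EuclideanSpace ℝ (Fin d))) [IsProbabilityMeasure μ]
    (ν : ProbabilityMeasure (EuclideanSpace ℝ (Fin d))) (hac : μ ≪ volume) :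
    ν ∈ closure (gradSet μ) := by
  rw [← closure_closure]
  let f : ℕ → SimpleFunc (EuclideanSpace ℝ (Fin d)) (EuclideanSpace ℝ (Fin d)) :=
    SimpleFunc.approxOn id measurable_id univ 0 (mem_univ _)
  let ρs : ℕ → ProbabilityMeasure (EuclideanSpace ℝ (Fin d)) := fun n =>
    ⟨(ν : Measure _).map (f n), Measure.isProbabilityMeasure_map (f n).measurable.aemeasurable⟩
  refine mem_closure_of_tendsto (f := ρs) (b := atTop) ?_
    (Eventually.of_forall fun n => simple_mem_closure μ ν hac (f n) _ rfl)
  rw [ProbabilityMeasure.tendsto_iff_forall_integral_tendsto]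
  intro g
  have h : Tendsto (fun n => ∫ x, g (f n x) ∂(ν : Measure _)) atTop
      (𝓝 (∫ x, g x ∂(ν : Measure _))) := by
    refine tendsto_integral_of_dominated_convergence (fun _ => ‖g‖) (fun n => ?_)
      (integrable_const _) (fun n => Eventually.of_forall fun x => g.norm_coe_le_norm _) ?_
    · exact (g.continuous.measurable.comp (f n).measurable).aestronglyMeasurable
    · refine Eventually.of_forall fun x => (g.continuous.tendsto _).comp ?_
      exact SimpleFunc.tendsto_approxOn measurable_id (mem_univ _) (by simp)
  refine h.congr fun n => ?_
  exact (integral_map (f n).measurable.aemeasurable g.continuous.aestronglyMeasurable).symm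

end GP

/-- Universality: for Borel probability measures `μ, ν` on `ℝᵈ` with `μ` absolutely continuous
w.r.t. Lebesgue, there are differentiable convex potentials `Fₙ` whose gradient pushforwards
`(∇Fₙ)_* μ` converge weakly to `ν`. -/
theorem exists_convex_potentials_gradient_pushforward_tendsto
    (d : ℕ) (μ ν : Measure (EuclideanSpace ℝ (Fin d)))
    [IsProbabilityMeasure μ] [IsProbabilityMeasure ν]
    (hac : μ ≪ volume) :
    ∃ F : ℕ → EuclideanSpace ℝ (Fin d) → ℝ,
      (∀ n, Differentiable ℝ (F n)) ∧ (∀ n, ConvexOn ℝ univ (F n)) ∧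
      ∀ g : BoundedContinuousFunction (EuclideanSpace ℝ (Fin d)) ℝ,
        Tendsto (fun n => ∫ x, g x ∂(μ.map (fun x => gradient (F n) x)))
          atTop (𝓝 (∫ y, g y ∂ν)) := by
  have h := GP.mem_closure μ ⟨ν, inferInstance⟩ hac
  obtain ⟨ρ, hρ, hlim⟩ := mem_closure_iff_seq_limit.1 h
  choose F hF using hρ
  refine ⟨F, fun n => (hF n).1, fun n => (hF n).2.1, fun g => ?_⟩
  have h1 := ProbabilityMeasure.tendsto_iff_forall_integral_tendsto.1 hlim g
  refine h1.congr fun n => ?_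
  rw [(hF n).2.2]
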